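/- Let S₀ be a finite set of odd primes and Γ_S the subgroup of Λ_S generated by the classes of the elements of A_p for p ∈ S₀. If every p ∈ S₀ satisfies p ≡ 1 (mod 4), or if every p ∈ S₀ satisfies p ≡ ±1 (mod 8), then Γ_S is torsion-free: every element of Γ_S of finite order is the identity. -/

import Mathlib

open Quaternion

noncomputable section

/-- The ring `ℤ_S = ℤ[1/(2·∏_{p∈S₀} p)]`, realized as the subring of `ℚ` generated by
`1/2` and `1/p` for `p ∈ S₀`. -/
def ZS (S₀ : Finset ℕ) : Subring ℚ :=
  Subring.closure ({(2 : ℚ)⁻¹} ∪ {x : ℚ | ∃ p ∈ S₀, x = (p : ℚ)⁻¹})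

/-- The central subgroup of scalar units of an `R`-algebra. -/
def scalarUnits (R A : Type*) [CommRing R] [Ring A] [Algebra R A] : Subgroup Aˣ :=
  (Units.map (algebraMap R A).toMonoidHom).range

instance scalarUnits_normal (R A : Type*) [CommRing R] [Ring A] [Algebra R A] :
    (scalarUnits R A).Normal := by
  constructor
  intro n hn g
  obtain ⟨r, rfl⟩ := hn
  refine ⟨r, Units.ext ?_⟩
  simp only [Units.val_mul, Units.coe_map, RingHom.toMonoidHom_eq_coe, MonoidHom.coe_coe]
  rw [← Algebra.commutes (r : R) ((g : Aˣ) : A), mul_assoc, Units.mul_inv, mul_one]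

/-- The group `Λ_S = ℍ[ℤ_S]ˣ/ℤ_Sˣ`. -/
abbrev LambdaH (S₀ : Finset ℕ) : Type :=
  ℍ[(ZS S₀)]ˣ ⧸ scalarUnits (ZS S₀) ℍ[(ZS S₀)]

/-- The class `[w]` of a unit `w`. -/
abbrev clsH (S₀ : Finset ℕ) : ℍ[(ZS S₀)]ˣ →* LambdaH S₀ :=
  QuotientGroup.mk' _

/-- The set `A_p` of integer quaternions of reduced norm `p` congruent to `1`
(if `p ≡ 1 mod 4`), resp. to `i + j + k` (if `p ≡ 3 mod 4`), modulo `2ℤ[i,j,k]`. -/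
def Ap (S₀ : Finset ℕ) (p : ℕ) : Set ℍ[(ZS S₀)] :=
  {x | ∃ a b c d : ℤ,
    x = (⟨(a : ZS S₀), (b : ZS S₀), (c : ZS S₀), (d : ZS S₀)⟩ : ℍ[(ZS S₀)]) ∧
    a ^ 2 + b ^ 2 + c ^ 2 + d ^ 2 = (p : ℤ) ∧
    ((p % 4 = 1 ∧ Odd a ∧ Even b ∧ Even c ∧ Even d) ∨
     (p % 4 = 3 ∧ Even a ∧ Odd b ∧ Odd c ∧ Odd d))}

/-- The group `Γ_S ⊆ Λ_S`, generated by the classes of the elements of `A_p`, `p ∈ S₀`. -/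
def GammaH (S₀ : Finset ℕ) : Subgroup (LambdaH S₀) :=
  Subgroup.closure {z | ∃ p ∈ S₀, ∃ w : ℍ[(ZS S₀)]ˣ,
    (w : ℍ[(ZS S₀)]) ∈ Ap S₀ p ∧ z = clsH S₀ w}

/-- The image in `ℍ[R]` of an integer quaternion. -/
def quatCastFun (R : Type*) [CommRing R] (q : ℍ[ℤ]) : ℍ[R] :=
  ⟨q.re, q.imI, q.imJ, q.imK⟩

section

variable (R : Type*) [CommRing R] (q : ℍ[ℤ])

@[simp] theorem re_quatCastFun : (quatCastFun R q).re = q.re := rfl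

@[simp] theorem imI_quatCastFun : (quatCastFun R q).imI = q.imI := rfl

@[simp] theorem imJ_quatCastFun : (quatCastFun R q).imJ = q.imJ := rfl

@[simp] theorem imK_quatCastFun : (quatCastFun R q).imK = q.imK := rfl

/-- The multiplicative map `ℍ[ℤ] → ℍ[R]` induced by `ℤ → R`. -/
def quatCast : ℍ[ℤ] →* ℍ[R] where
  toFun := quatCastFun R
  map_one' := by ext <;> simp
  map_mul' x y := by ext <;> simp

theorem quatCast_apply : quatCast R q = quatCastFun R q := rfl

theorem quatCast_star : quatCast R (star q) = star (quatCast R q) := by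
  simp only [quatCast_apply]
  ext <;> simp

end

/-- The integer quaternions congruent to `1` modulo `2`. -/
def oddRealQuat : Submonoid ℍ[ℤ] where
  carrier := {q | Odd q.re ∧ Even q.imI ∧ Even q.imJ ∧ Even q.imK}
  one_mem' := by simp
  mul_mem' := by
    rintro x y ⟨h1, h2, h3, h4⟩ ⟨h5, h6, h7, h8⟩
    rw [← Int.not_even_iff_odd] at h1 h5
    simp [← Int.not_even_iff_odd, Int.even_add, Int.even_sub, Int.even_mul, *]

/-- The integer quaternions of reduced norm `±1` modulo `8` whose imaginary coordinates all have
the same parity. -/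
def normPmOneQuat : Submonoid ℍ[ℤ] where
  carrier := {q | Even (q.imI - q.imJ) ∧ Even (q.imJ - q.imK) ∧
    (normSq q % 8 = 1 ∨ normSq q % 8 = 7)}
  one_mem' := by simp
  mul_mem' := by
    rintro x y ⟨h1, h2, h3⟩ ⟨h4, h5, h6⟩
    refine ⟨?_, ?_, ?_⟩
    · clear h3 h6
      simp only [Quaternion.imI_mul, Quaternion.imJ_mul, Int.even_add, Int.even_sub,
        Int.even_mul] at *
      grind
    · clear h3 h6
      simp only [Quaternion.imJ_mul, Quaternion.imK_mul, Int.even_add, Int.even_sub,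
        Int.even_mul] at *
      grind
    · rw [map_mul, Int.mul_emod]
      rcases h3 with h3 | h3 <;> rcases h6 with h6 | h6 <;> simp [h3, h6]

theorem odd_normSq_of_mem_oddRealQuat {q : ℍ[ℤ]} (hq : q ∈ oddRealQuat) : Odd (normSq q) := by
  obtain ⟨h1, h2, h3, h4⟩ := hq
  rw [← Int.not_even_iff_odd] at h1
  simp [normSq_def', ← Int.not_even_iff_odd, Int.even_add, Int.even_pow, *]

theorem re_ne_zero_of_mem_oddRealQuat {q : ℍ[ℤ]} (hq : q ∈ oddRealQuat) : q.re ≠ 0 := by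
  intro h
  have := hq.1
  simp [h] at this

theorem star_mem_oddRealQuat {q : ℍ[ℤ]} (hq : q ∈ oddRealQuat) : star q ∈ oddRealQuat := by
  obtain ⟨h1, h2, h3, h4⟩ := hq
  exact ⟨by simpa, by simpa, by simpa, by simpa⟩

theorem odd_normSq_of_mem_normPmOneQuat {q : ℍ[ℤ]} (hq : q ∈ normPmOneQuat) :
    Odd (normSq q) := by
  obtain ⟨-, -, h⟩ := hq
  rw [Int.odd_iff]
  omega

theorem re_ne_zero_of_mem_normPmOneQuat {q : ℍ[ℤ]} (hq : q ∈ normPmOneQuat) : q.re ≠ 0 := by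
  intro h
  have hodd := odd_normSq_of_mem_normPmOneQuat hq
  obtain ⟨h1, h2, h3⟩ := hq
  rw [← Int.not_even_iff_odd] at hodd
  simp only [normSq_def', h, Int.even_add, Int.even_pow, Int.even_sub] at *
  have hI : Odd q.imI := by rw [← Int.not_even_iff_odd]; simp at hodd; tauto
  have hJ : Odd q.imJ := by rw [← Int.not_even_iff_odd]; simp at hodd; tauto
  have hK : Odd q.imK := by rw [← Int.not_even_iff_odd]; simp at hodd; tauto
  have eI := Int.eight_dvd_sq_sub_one_of_odd hI
  have eJ := Int.eight_dvd_sq_sub_one_of_odd hJ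
  have eK := Int.eight_dvd_sq_sub_one_of_odd hK
  omega

theorem star_mem_normPmOneQuat {q : ℍ[ℤ]} (hq : q ∈ normPmOneQuat) :
    star q ∈ normPmOneQuat := by
  obtain ⟨h1, h2, h3⟩ := hq
  refine ⟨?_, ?_, by rwa [normSq_star]⟩ <;>
  · simp only [Quaternion.imI_star, Quaternion.imJ_star, Quaternion.imK_star, Int.even_sub,
      even_neg] at *
    assumption

/-- An odd power of an integer quaternion `q` of odd norm is an odd multiple of `q` plus a
scalar. -/
theorem exists_odd_pow_eq {q : ℍ[ℤ]} (hq : Odd (normSq q)) (m : ℕ) :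
    ∃ u v : ℤ, Odd u ∧ q ^ (2 * m + 1) = u • q + v • 1 := by
  induction m with
  | zero => exact ⟨1, 0, odd_one, by simp⟩
  | succ m ih =>
    obtain ⟨u, v, hu, h⟩ := ih
    refine ⟨4 * q.re ^ 2 * u + 2 * q.re * v - normSq q * u,
      -(2 * q.re * u * normSq q) - normSq q * v, ?_, ?_⟩
    · rw [← Int.not_even_iff_odd] at *
      simp [Int.even_add, Int.even_sub, Int.even_mul, Int.even_pow, *]
      tauto
    · rw [show 2 * (m + 1) + 1 = 2 * m + 1 + 1 + 1 by ring, pow_succ, pow_succ, h]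
      ext <;> simp only [normSq_def', smul_eq_mul,
        Quaternion.re_add, Quaternion.re_mul, Quaternion.re_smul, Quaternion.re_one,
        Quaternion.imI_add, Quaternion.imI_mul, Quaternion.imI_smul, Quaternion.imI_one,
        Quaternion.imJ_add, Quaternion.imJ_mul, Quaternion.imJ_smul, Quaternion.imJ_one,
        Quaternion.imK_add, Quaternion.imK_mul, Quaternion.imK_smul, Quaternion.imK_one] <;> ring

/-- The imaginary part of an integer quaternion of odd norm vanishes as soon as that of some odd
power does. -/
theorem im_eq_zero_of_pow_odd {q : ℍ[ℤ]} (hq : Odd (normSq q)) {n : ℕ} (hn : Odd n)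
    (h : (q ^ n).im = 0) : q.im = 0 := by
  obtain ⟨m, rfl⟩ := hn
  obtain ⟨u, v, hu, e⟩ := exists_odd_pow_eq hq m
  have hu0 : u ≠ 0 := by rintro rfl; simp at hu
  rw [e] at h
  simpa [Quaternion.ext_iff, hu0] using h

theorem im_eq_zero_of_sq {q : ℍ[ℤ]} (hq : q.re ≠ 0) (h : (q ^ 2).im = 0) : q.im = 0 := by
  simp only [Quaternion.ext_iff, Quaternion.re_im, Quaternion.imI_im, Quaternion.imJ_im,
    Quaternion.imK_im, sq, Quaternion.imI_mul, Quaternion.imJ_mul, Quaternion.imK_mul,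
    Quaternion.re_zero, Quaternion.imI_zero, Quaternion.imJ_zero, Quaternion.imK_zero] at *
  obtain ⟨-, h1, h2, h3⟩ := h
  refine ⟨trivial, ?_, ?_, ?_⟩
  · exact (mul_eq_zero.1 (by linarith : q.re * q.imI = 0)).resolve_left hq
  · exact (mul_eq_zero.1 (by linarith : q.re * q.imJ = 0)).resolve_left hq
  · exact (mul_eq_zero.1 (by linarith : q.re * q.imK = 0)).resolve_left hq

theorem clsH_eq_one_iff (S₀ : Finset ℕ) {w : ℍ[(ZS S₀)]ˣ} {q : ℍ[ℤ]}
    (hw : (w : ℍ[(ZS S₀)]) = quatCast (ZS S₀) q) : clsH S₀ w = 1 ↔ q.im = 0 := by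
  rw [QuotientGroup.mk'_apply, QuotientGroup.eq_one_iff]
  constructor
  · rintro ⟨r, rfl⟩
    have h : ((r : ZS S₀) : ℍ[(ZS S₀)]) = quatCast (ZS S₀) q := hw
    have hI := congrArg QuaternionAlgebra.imI h
    have hJ := congrArg QuaternionAlgebra.imJ h
    have hK := congrArg QuaternionAlgebra.imK h
    simp only [quatCast_apply, imI_quatCastFun, imJ_quatCastFun, imK_quatCastFun, Quaternion.imI_coe,
      Quaternion.imJ_coe, Quaternion.imK_coe] at hI hJ hK
    ext
    · simp
    · exact_mod_cast hI.symm
    · exact_mod_cast hJ.symm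
    · exact_mod_cast hK.symm
  · intro h
    have hw' : (w : ℍ[(ZS S₀)]) = ((q.re : ZS S₀) : ℍ[(ZS S₀)]) := by
      simp only [Quaternion.ext_iff, Quaternion.re_im, Quaternion.imI_im, Quaternion.imJ_im,
        Quaternion.imK_im, Quaternion.imI_zero, Quaternion.imJ_zero, Quaternion.imK_zero] at h
      obtain ⟨-, hI, hJ, hK⟩ := h
      rw [hw, quatCast_apply]
      ext <;> simp [hI, hJ, hK]
    have hu : IsUnit (normSq (w : ℍ[(ZS S₀)])) := w.isUnit.map normSq
    rw [hw', normSq_coe, isUnit_pow_iff two_ne_zero] at hu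
    obtain ⟨r, hr⟩ := hu
    exact ⟨r, Units.ext (by rw [hw', ← hr]; rfl)⟩

theorem clsH_inv (S₀ : Finset ℕ) (w : ℍ[(ZS S₀)]ˣ) : (clsH S₀ w)⁻¹ = clsH S₀ (star w) := by
  rw [inv_eq_iff_mul_eq_one, ← map_mul, QuotientGroup.mk'_apply, QuotientGroup.eq_one_iff]
  refine ⟨Units.map normSq.toMonoidHom w, Units.ext ?_⟩
  exact (Quaternion.self_mul_star (w : ℍ[(ZS S₀)])).symm

/-- The classes in `Λ_S` of the units coming from a star-closed monoid of integer quaternions. -/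
def classesOf (S₀ : Finset ℕ) (M : Submonoid ℍ[ℤ]) (hM : ∀ q ∈ M, star q ∈ M) :
    Subgroup (LambdaH S₀) where
  carrier := {z | ∃ w : ℍ[(ZS S₀)]ˣ, ∃ q ∈ M,
    (w : ℍ[(ZS S₀)]) = quatCast (ZS S₀) q ∧ z = clsH S₀ w}
  one_mem' := ⟨1, 1, M.one_mem, by simp, by simp⟩
  mul_mem' := by
    rintro _ _ ⟨w, q, hq, hw, rfl⟩ ⟨w', q', hq', hw', rfl⟩
    exact ⟨w * w', q * q', M.mul_mem hq hq', by simp [hw, hw'], by simp⟩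
  inv_mem' := by
    rintro _ ⟨w, q, hq, hw, rfl⟩
    exact ⟨star w, star q, hM q hq, by rw [quatCast_star, ← hw, Units.coe_star], clsH_inv S₀ w⟩

theorem eq_one_of_mem_classesOf {S₀ : Finset ℕ} {M : Submonoid ℍ[ℤ]}
    (hM : ∀ q ∈ M, star q ∈ M) (hre : ∀ q ∈ M, q.re ≠ 0) (hodd : ∀ q ∈ M, Odd (normSq q)) (n : ℕ) :
    0 < n → ∀ z ∈ classesOf S₀ M hM, z ^ n = 1 → z = 1 := by
  induction n using Nat.strong_induction_on with
  | _ n ih =>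
  intro hn z hz hzn
  rcases Nat.even_or_odd' n with ⟨m, rfl | rfl⟩
  · refine ih m (by omega) (by omega) z hz ?_
    obtain ⟨w, q, hq, hw, e⟩ := pow_mem hz m
    have hw2 : ((w ^ 2 : ℍ[(ZS S₀)]ˣ) : ℍ[(ZS S₀)]) = quatCast (ZS S₀) (q ^ 2) := by simp [hw]
    rw [mul_comm, pow_mul, e, ← map_pow, clsH_eq_one_iff S₀ hw2] at hzn
    rw [e, clsH_eq_one_iff S₀ hw]
    exact im_eq_zero_of_sq (hre q hq) hzn
  · obtain ⟨w, q, hq, hw, rfl⟩ := hz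
    have hwn : ((w ^ (2 * m + 1) : ℍ[(ZS S₀)]ˣ) : ℍ[(ZS S₀)]) =
        quatCast (ZS S₀) (q ^ (2 * m + 1)) := by simp [hw]
    rw [← map_pow, clsH_eq_one_iff S₀ hwn] at hzn
    rw [clsH_eq_one_iff S₀ hw]
    exact im_eq_zero_of_pow_odd (hodd q hq) ⟨m, rfl⟩ hzn

theorem gammaH_torsionFree_of_submonoid {S₀ : Finset ℕ} {M : Submonoid ℍ[ℤ]}
    (hM : ∀ q ∈ M, star q ∈ M) (hre : ∀ q ∈ M, q.re ≠ 0) (hodd : ∀ q ∈ M, Odd (normSq q))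
    (hA : ∀ p ∈ S₀, ∀ x ∈ Ap S₀ p, ∃ q ∈ M, x = quatCast (ZS S₀) q) :
    ∀ g : GammaH S₀, IsOfFinOrder g → g = 1 := by
  have hle : GammaH S₀ ≤ classesOf S₀ M hM := by
    refine (Subgroup.closure_le _).2 ?_
    rintro _ ⟨p, hp, w, hw, rfl⟩
    obtain ⟨q, hq, e⟩ := hA p hp _ hw
    exact ⟨w, q, hq, e, rfl⟩
  intro g hg
  obtain ⟨n, hn, h⟩ := isOfFinOrder_iff_pow_eq_one.1 hg
  refine Subtype.ext (eq_one_of_mem_classesOf hM hre hodd n hn g (hle g.2) ?_)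
  exact_mod_cast congrArg Subtype.val h

/-- If every `p ∈ S₀` satisfies `p ≡ 1 (mod 4)`, or every `p ∈ S₀`
satisfies `p ≡ ±1 (mod 8)`, then `Γ_S` is torsion-free. -/
theorem gammaH_torsionFree
    (S₀ : Finset ℕ) (hS₀ : ∀ p ∈ S₀, p.Prime ∧ Odd p)
    (hcong : (∀ p ∈ S₀, p % 4 = 1) ∨ (∀ p ∈ S₀, p % 8 = 1 ∨ p % 8 = 7)) :
    ∀ g : GammaH S₀, IsOfFinOrder g → g = 1 := by
  rcases hcong with hc | hc
  · refine gammaH_torsionFree_of_submonoid (M := oddRealQuat) (fun _ ↦ star_mem_oddRealQuat)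
      (fun _ ↦ re_ne_zero_of_mem_oddRealQuat) (fun _ ↦ odd_normSq_of_mem_oddRealQuat) ?_
    rintro p hp _ ⟨a, b, c, d, rfl, -, ⟨-, h⟩ | ⟨h, -⟩⟩
    · exact ⟨⟨a, b, c, d⟩, h, rfl⟩
    · have := hc p hp
      omega
  · refine gammaH_torsionFree_of_submonoid (M := normPmOneQuat) (fun _ ↦ star_mem_normPmOneQuat)
      (fun _ ↦ re_ne_zero_of_mem_normPmOneQuat) (fun _ ↦ odd_normSq_of_mem_normPmOneQuat) ?_
    rintro p hp _ ⟨a, b, c, d, rfl, hN, h⟩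
    refine ⟨⟨a, b, c, d⟩, ⟨?_, ?_, ?_⟩, rfl⟩
    · rcases h with ⟨-, -, hb, hc, -⟩ | ⟨-, -, hb, hc, -⟩
      exacts [hb.sub hc, hb.sub_odd hc]
    · rcases h with ⟨-, -, -, hc, hd⟩ | ⟨-, -, -, hc, hd⟩
      exacts [hc.sub hd, hc.sub_odd hd]
    · have := hc p hp
      have hN' : normSq (⟨a, b, c, d⟩ : ℍ[ℤ]) = p := (normSq_def' _).trans hN
      rw [hN']
      omega
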